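/- There exists a constant c ≥ 1 such that for every 2-TVASS V = (Q, Σ, Δ) that is bounded from an initial configuration p(x⃗), every configuration q(y⃗) reachable from p(x⃗) satisfies ‖y⃗‖ ≤ (1 + ‖x⃗‖)·(|Q| + ‖Σ‖)^{c·|Q|³}. -/

import Mathlib

namespace TVASSpaper

/-- Actions of a `d`-TVASS: `some a` is an addition of the vector `a ∈ ℤ^d`,
    `none` is the zero-test action `tst` (on the first counter). -/
abbrev Act (d : ℕ) := Option (Fin d → ℤ)

/-- Transitions. -/
abbrev Trans (d : ℕ) (Q : Type) := Q × Act d × Q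

/-- Configurations: a state together with a vector of `d` counters. -/
abbrev Config (d : ℕ) (Q : Type) := Q × (Fin d → ℕ)

/-- A `d`-TVASS: a finite set `acts` of actions and a finite set of transitions
    `trans ⊆ Q × acts × Q`. The state set `Q` is a (finite, nonempty) type. -/
structure TVASS (d : ℕ) (Q : Type) where
  acts : Finset (Act d)
  trans : Finset (Trans d Q)
  mem_acts : ∀ t ∈ trans, t.2.1 ∈ acts

variable {d : ℕ} {Q : Type}

/-- The step induced by a single transition: an addition transition `(p, a, q)`
    induces `p(x) → q(x + a)` whenever `x + a ∈ ℕ^d`; a zero-test transition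
    `(p, tst, q)` induces `p(x) → q(x)` whenever the first counter is `0`. -/
def StepBy [NeZero d] (t : Trans d Q) (c c' : Config d Q) : Prop :=
  t.1 = c.1 ∧ t.2.2 = c'.1 ∧
    match t.2.1 with
    | some a => ∀ i, (c'.2 i : ℤ) = (c.2 i : ℤ) + a i
    | none => c.2 0 = 0 ∧ c'.2 = c.2

/-- `Run V c π c'` : there is a run from `c` to `c'` taking the steps of the
    word of transitions `π` in order. -/
inductive Run [NeZero d] (V : TVASS d Q) :
    Config d Q → List (Trans d Q) → Config d Q → Prop
  | nil (c : Config d Q) : Run V c [] c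
  | cons {t : Trans d Q} {c c' c'' : Config d Q} {π : List (Trans d Q)} :
      t ∈ V.trans → StepBy t c c' → Run V c' π c'' → Run V c (t :: π) c''

/-- One step of the TVASS. -/
def Step [NeZero d] (V : TVASS d Q) (c c' : Config d Q) : Prop :=
  ∃ t ∈ V.trans, StepBy t c c'

/-- Reachability `c →* c'`. -/
def Reach [NeZero d] (V : TVASS d Q) (c c' : Config d Q) : Prop :=
  ∃ π, Run V c π c'

/-- `IsPathFrom V p π q` : `π` is a path (word of transitions of `V` with
    matching endpoints) from state `p` to state `q`. -/
inductive IsPathFrom (V : TVASS d Q) : Q → List (Trans d Q) → Q → Prop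
  | nil (p : Q) : IsPathFrom V p [] p
  | cons {t : Trans d Q} {π : List (Trans d Q)} {q : Q} :
      t ∈ V.trans → IsPathFrom V t.2.2 π q → IsPathFrom V t.1 (t :: π) q

/-- `n`-fold concatenation of a word. -/
def pw {α : Type*} (l : List α) (n : ℕ) : List α := (List.replicate n l).flatten

/-- A linear path scheme `α₀ β₁* α₁ ⋯ β_k* α_k`, given by the head path `α₀`
    and the list of pairs `(β₁, α₁), …, (β_k, α_k)`. -/
structure LPS (d : ℕ) (Q : Type) where
  head : List (Trans d Q)
  rest : List (List (Trans d Q) × List (Trans d Q))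

/-- Length `|L|` of a linear path scheme. -/
def LPS.len (L : LPS d Q) : ℕ :=
  L.head.length + (L.rest.map fun p => p.1.length + p.2.length).sum

/-- Number of stars `|L|_*` of a linear path scheme. -/
def LPS.stars (L : LPS d Q) : ℕ := L.rest.length

def wordRest : List (List (Trans d Q) × List (Trans d Q)) → List ℕ → List (Trans d Q)
  | [], _ => []
  | p :: rest, ns => pw p.1 (ns.headD 0) ++ p.2 ++ wordRest rest ns.tail

/-- The word `α₀ β₁^{n₁} α₁ ⋯ β_k^{n_k} α_k` of `L` for exponents `ns`. -/
def LPS.word (L : LPS d Q) (ns : List ℕ) : List (Trans d Q) :=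
  L.head ++ wordRest L.rest ns

/-- Well-formedness of the tail of a linear path scheme starting in state `s`:
    the `βᵢ` are cycles and the `αᵢ` are paths, with matching endpoints. -/
inductive ChainLPS (V : TVASS d Q) :
    Q → List (List (Trans d Q) × List (Trans d Q)) → Q → Prop
  | nil (q : Q) : ChainLPS V q [] q
  | cons {s s' q : Q} {β α : List (Trans d Q)}
      {rest : List (List (Trans d Q) × List (Trans d Q))} :
      IsPathFrom V s β s → IsPathFrom V s α s' → ChainLPS V s' rest q →
      ChainLPS V s ((β, α) :: rest) q

/-- `L` is a genuine linear path scheme from `p` to `q` in `V`. -/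
def IsLPS (V : TVASS d Q) (p : Q) (L : LPS d Q) (q : Q) : Prop :=
  ∃ s, IsPathFrom V p L.head s ∧ ChainLPS V s L.rest q

/-- `c →^L c'` : reachability along the linear path scheme `L`. -/
def ReachLPS [NeZero d] (V : TVASS d Q) (L : LPS d Q) (c c' : Config d Q) : Prop :=
  ∃ ns, Run V c (L.word ns) c'

/-- `‖x⃗‖`: maximum component of a vector of naturals. -/
def vnorm {d : ℕ} (v : Fin d → ℕ) : ℕ := Finset.univ.sup v

/-- Maximum absolute value of a component of an integer vector. -/
def vnormZ {d : ℕ} (v : Fin d → ℤ) : ℕ := Finset.univ.sup fun i => (v i).natAbs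

/-- `‖Σ‖`: maximum absolute value of a component of a vector in `Σ ∖ {tst}`
    (0 if `Σ ⊆ {tst}`). -/
def TVASS.actNorm (V : TVASS d Q) : ℕ :=
  V.acts.sup fun a => a.elim 0 vnormZ

/-- Displacement of a word of transitions (zero-tests contribute `0`). -/
def disp (π : List (Trans d Q)) : Fin d → ℤ :=
  fun i => (π.map fun t => (t.2.1.elim 0 id : Fin d → ℤ) i).sum

/-- `m_π(i)`: max over prefixes `α` of `π` (including the empty prefix) of `-Δ(α)(i)`. -/
def mpre (π : List (Trans d Q)) (i : Fin d) : ℤ :=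
  (π.inits.map fun α => -(disp α i)).foldr max 0

/-- `m_π̄(i)`: max over suffixes `σ` of `π` (including the empty suffix) of `Δ(σ)(i)`. -/
def msuf (π : List (Trans d Q)) (i : Fin d) : ℤ :=
  (π.tails.map fun σ => disp σ i).foldr max 0

/-- `π` contains no zero-test transition. -/
def noTst (π : List (Trans d Q)) : Prop := ∀ t ∈ π, t.2.1 ≠ none

/-- `x⃗ ≥₁ m⃗` : `x⃗(1) = m⃗(1)` and `x⃗(i) ≥ m⃗(i)` for all other `i`. -/
def ge1 [NeZero d] (x : Fin d → ℕ) (m : Fin d → ℤ) : Prop :=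
  (x 0 : ℤ) = m 0 ∧ ∀ i : Fin d, i ≠ 0 → m i ≤ (x i : ℤ)

/-- A path from `p` to `q` is feasible if some run takes it. -/
def Feasible [NeZero d] (V : TVASS d Q) (p : Q) (π : List (Trans d Q)) (q : Q) : Prop :=
  ∃ x y, Run V (p, x) π (q, y)

/-- `c →^{A* ∪ T} c'` : there is a run from `c` to `c'` whose path either
    contains no zero-test transition, or is a single zero-test transition. -/
def ReachAT [NeZero d] (V : TVASS d Q) (c c' : Config d Q) : Prop :=
  ∃ π, Run V c π c' ∧ (noTst π ∨ ∃ t : Trans d Q, π = [t] ∧ t.2.1 = none)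

/-- `p ⇝ q` for a 2-TVASS: `p(0, x) →* q(0, y)` for some `x, y ∈ ℕ`. -/
def Leads (V : TVASS 2 Q) (p q : Q) : Prop :=
  ∃ x y : ℕ, Reach V (p, ![0, x]) (q, ![0, y])

/-- The linear path scheme `L` is bounded from the configuration `c`: the set of
    configurations reachable from `c` along a prefix of a path in `L` is finite. -/
def BoundedLPS [NeZero d] (V : TVASS d Q) (L : LPS d Q) (c : Config d Q) : Prop :=
  {c' : Config d Q | ∃ ns ρ, ρ <+: L.word ns ∧ Run V c ρ c'}.Finite


/-! ### Chains: last visits -/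

section Chains

open Relation

variable {C K : Type*}

theorem chain_mono {R R' : C → C → Prop} {c c' : C} (h : ReflTransGen R c c')
    (hR : ∀ a b, R a b → R' a b) : ReflTransGen R' c c' :=
  ReflTransGen.mono hR _ _ h

/-- Last visit of a chain to the key of its first element. -/
theorem exists_last_visit {R : C → C → Prop} (key : C → K) {c c' : C}
    (h : ReflTransGen R c c') :
    ∃ d, ReflTransGen R c d ∧ key d = key c ∧
      (d = c' ∨ ∃ e, R d e ∧ key e ≠ key c ∧
        ReflTransGen (fun a b => R a b ∧ key b ≠ key c) e c') := by
  induction h with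
  | refl => exact ⟨c, .refl, rfl, .inl rfl⟩
  | @tail m c' hm hs ih =>
    by_cases hk : key c' = key c
    · exact ⟨c', hm.tail hs, hk, .inl rfl⟩
    obtain ⟨d, hd, hkd, rfl | ⟨e, hde, hke, he⟩⟩ := ih
    · exact ⟨d, hd, hkd, .inr ⟨c', hs, hk, .refl⟩⟩
    · exact ⟨d, hd, hkd, .inr ⟨e, hde, hke, he.tail ⟨hs, hk⟩⟩⟩

/-- Growth along a chain visiting few keys, when the growth between two visits to the same key
is controlled by `F` and the growth of a single step is controlled by `G`. -/
theorem chain_growth {R : C → C → Prop} (key : C → K) (g : C → ℕ)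
    (Inv : C → Prop) (hInv : ∀ c d, Inv c → R c d → Inv d)
    {F G : ℕ → ℕ} (hF : ∀ n, n ≤ F n) (hG : ∀ n, n ≤ G n) (hGm : Monotone G) (hFm : Monotone F)
    (hsame : ∀ c d, Inv c → ReflTransGen R c d → key d = key c → g d ≤ F (g c))
    (hstep : ∀ c d, Inv c → R c d → g d ≤ G (g c)) (S : Finset K) :
    ∀ c c', Inv c → key c ∈ S → ReflTransGen (fun a b => R a b ∧ key b ∈ S) c c' →
      g c' ≤ (G ∘ F)^[S.card] (g c) := by
  classical
  have hInv' : ∀ c d, Inv c → ReflTransGen R c d → Inv d := by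
    intro c d hc h
    induction h with
    | refl => exact hc
    | tail _ hs ih => exact hInv _ _ ih hs
  induction S using Finset.strongInduction with
  | H S ih =>
  intro c c' hc hcS h
  obtain ⟨d, hd, hkd, h'⟩ := exists_last_visit key h
  have hd' : ReflTransGen R c d := chain_mono hd fun _ _ h => h.1
  have hcard : (S.erase (key c)).card + 1 = S.card := Finset.card_erase_add_one hcS
  have hinfl : ∀ k n, n ≤ (G ∘ F)^[k] n := fun k n =>
    Function.id_le_iterate_of_id_le (f := G ∘ F) (fun n => (hF n).trans (hG _)) k n
  have hm : Monotone (G ∘ F) := hGm.comp hFm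
  rw [← hcard, Function.iterate_succ_apply]
  have hgd := hsame c d hc hd' hkd
  obtain rfl | ⟨e, ⟨hde, heS⟩, hke, he⟩ := h'
  · exact (hgd.trans (hG _)).trans (hinfl _ _)
  · have hge : g e ≤ (G ∘ F) (g c) :=
      (hstep d e (hInv' c d hc hd') hde).trans (hGm hgd)
    refine (ih _ (Finset.erase_ssubset hcS) e c' (hInv' c e hc (hd'.tail hde))
      (Finset.mem_erase.2 ⟨hke, heS⟩) ?_).trans (hm.iterate _ hge)
    exact chain_mono he fun a b h => ⟨h.1.1, Finset.mem_erase.2 ⟨h.2, h.1.2⟩⟩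

theorem reflTransGen_restrict {R : C → C → Prop} {P : C → Prop} {c c' : C}
    (h : ReflTransGen R c c')
    (hP : ∀ d, ReflTransGen R c d → ReflTransGen R d c' → P d) :
    ReflTransGen (fun a b => R a b ∧ P b) c c' := by
  induction h with
  | refl => exact .refl
  | @tail m c' hm hs ih =>
    exact (ih fun d hd hd' => hP d hd (hd'.tail hs)).tail ⟨hs, hP _ (hm.tail hs) .refl⟩

end Chains

/-! ### Walks in the test-free part -/

section Walks

open Relation

variable (V : TVASS 2 Q)

/-- Addition edges. -/
def Edge (p : Q) (a : Fin 2 → ℤ) (q : Q) : Prop := (p, some a, q) ∈ V.trans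

/-- Test-free steps. -/
def AddStep (c c' : Config 2 Q) : Prop :=
  ∃ a, Edge V c.1 a c'.1 ∧ ∀ i, (c'.2 i : ℤ) = c.2 i + a i

/-- Walks using addition edges, with their length and effect. -/
inductive Walk : Q → ℕ → (Fin 2 → ℤ) → Q → Prop
  | nil (p : Q) : Walk p 0 0 p
  | cons {p q r : Q} {a δ : Fin 2 → ℤ} {n : ℕ} :
      Edge V p a q → Walk q n δ r → Walk p (n + 1) (a + δ) r

/-- The set of configurations reachable from `c` is finite. -/
def Bounded (c : Config 2 Q) : Prop := {c' | ReflTransGen (Step V) c c'}.Finite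

variable {V}

theorem Edge.abs_le {p q : Q} {a : Fin 2 → ℤ} (h : Edge V p a q) (i : Fin 2) :
    |a i| ≤ V.actNorm := by
  have h1 : vnormZ a ≤ V.actNorm :=
    Finset.le_sup (f := fun a : Act 2 => a.elim 0 vnormZ) (V.mem_acts _ h)
  have h2 : (a i).natAbs ≤ vnormZ a :=
    Finset.le_sup (f := fun i => (a i).natAbs) (Finset.mem_univ i)
  rw [Int.abs_eq_natAbs]
  exact_mod_cast h2.trans h1

theorem AddStep.step {c c' : Config 2 Q} (h : AddStep V c c') : Step V c c' := by
  obtain ⟨a, ha, h⟩ := h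
  exact ⟨_, ha, rfl, rfl, h⟩

theorem step_cases {c c' : Config 2 Q} (h : Step V c c') :
    AddStep V c c' ∨ (c.2 0 = 0 ∧ c'.2 = c.2) := by
  obtain ⟨⟨p, a, q⟩, ht, rfl, rfl, h⟩ := h
  cases a with
  | none => exact .inr h
  | some a => exact .inl ⟨a, ht, h⟩

theorem AddStep.reach {c c' : Config 2 Q} (h : ReflTransGen (AddStep V) c c') :
    ReflTransGen (Step V) c c' := chain_mono h fun _ _ h => h.step

theorem reach_iff {c c' : Config 2 Q} : Reach V c c' ↔ ReflTransGen (Step V) c c' := by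
  constructor
  · rintro ⟨π, h⟩
    induction h with
    | nil => exact .refl
    | cons ht hs _ ih => exact .head ⟨_, ht, hs⟩ ih
  · intro h
    induction h using ReflTransGen.head_induction_on with
    | refl => exact ⟨[], .nil _⟩
    | head hs _ ih =>
      obtain ⟨t, ht, hs⟩ := hs
      obtain ⟨π, h⟩ := ih
      exact ⟨t :: π, .cons ht hs h⟩

theorem Bounded.of_reach {c c' : Config 2 Q} (hc : Bounded V c)
    (h : ReflTransGen (Step V) c c') : Bounded V c' :=
  hc.subset fun _ hd => h.trans hd

/-- A self-covering chain of a relation invariant under the translation by the increment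
contradicts boundedness. -/
theorem not_bounded_of_pump {R : Config 2 Q → Config 2 Q → Prop}
    (hR : ∀ c d, R c d → Step V c d) {v : Fin 2 → ℕ} (hv : v ≠ 0)
    (htr : ∀ c d : Config 2 Q, R c d → R (c.1, c.2 + v) (d.1, d.2 + v))
    {q : Q} {x : Fin 2 → ℕ} (h : ReflTransGen R (q, x) (q, x + v)) : ¬ Bounded V (q, x) := by
  have key : ∀ n : ℕ, ReflTransGen R (q, x + n • v) (q, x + (n + 1) • v) := by
    intro n
    induction n with
    | zero => simpa using h
    | succ n ih =>
      have : ReflTransGen R (q, x + n • v + v) (q, x + (n + 1) • v + v) :=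
        ReflTransGen.lift (fun c : Config 2 Q => (c.1, c.2 + v)) htr _ _ ih
      rwa [add_assoc, add_assoc, ← succ_nsmul, ← succ_nsmul] at this
  have hall : ∀ n : ℕ, ReflTransGen R (q, x) (q, x + n • v) := by
    intro n
    induction n with
    | zero => simpa using ReflTransGen.refl
    | succ n ih => exact ih.trans (key n)
  obtain ⟨i, hi⟩ := Function.ne_iff.1 hv
  intro hb
  refine Set.infinite_of_injective_forall_mem (f := fun n : ℕ => (q, x + n • v)) ?_
    (fun n => chain_mono (hall n) hR) hb
  intro m n hmn
  have := congrFun (Prod.ext_iff.1 hmn).2 i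
  simp only [Pi.add_apply, Pi.smul_apply, smul_eq_mul, add_right_inj] at this
  exact Nat.eq_of_mul_eq_mul_right (Nat.pos_of_ne_zero hi) this

theorem AddStep.translate (v : Fin 2 → ℕ) {c d : Config 2 Q} (h : AddStep V c d) :
    AddStep V (c.1, c.2 + v) (d.1, d.2 + v) := by
  obtain ⟨a, ha, h⟩ := h
  refine ⟨a, ha, fun i => ?_⟩
  have := h i
  simp only [Pi.add_apply, Nat.cast_add]
  omega

theorem Step.translate {v : Fin 2 → ℕ} (hv : v 0 = 0) {c d : Config 2 Q} (h : Step V c d) :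
    Step V (c.1, c.2 + v) (d.1, d.2 + v) := by
  obtain ⟨⟨p, a, q⟩, ht, rfl, rfl, h⟩ := h
  refine ⟨_, ht, rfl, rfl, ?_⟩
  cases a with
  | none =>
    obtain ⟨h0, h⟩ := h
    exact ⟨by simp [h0, hv], by simp [h]⟩
  | some a =>
    intro i
    have := h i
    simp only [Pi.add_apply, Nat.cast_add]
    omega

/-- In a bounded system a test-free chain cannot strictly increase. -/
theorem Bounded.not_lt {c d : Config 2 Q} (hc : Bounded V c)
    (h : ReflTransGen (AddStep V) c d) (hs : d.1 = c.1) : ¬ c.2 < d.2 := by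
  obtain ⟨q, x⟩ := c
  obtain ⟨r, y⟩ := d
  obtain rfl : r = q := hs
  intro hlt
  have hle : x ≤ y := hlt.le
  have hy : x + (y - x) = y := add_tsub_cancel_of_le hle
  refine not_bounded_of_pump (v := y - x) (fun _ _ h => AddStep.step h) ?_
    (fun _ _ h => h.translate _) (by rwa [hy]) hc
  intro h0
  rw [h0, add_zero] at hy
  exact hlt.ne hy

/-- In a bounded system, the second counter does not increase between two configurations
with the same state and first counter zero. -/
theorem Bounded.zero_le {c d : Config 2 Q} (hc : Bounded V c)
    (h : ReflTransGen (Step V) c d) (hs : d.1 = c.1) (hc0 : c.2 0 = 0) (hd0 : d.2 0 = 0) :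
    d.2 1 ≤ c.2 1 := by
  obtain ⟨q, x⟩ := c
  obtain ⟨r, y⟩ := d
  obtain rfl : r = q := hs
  by_contra! hlt
  have hle : x ≤ y := by
    intro i
    fin_cases i
    · exact (hc0.trans hd0.symm).le
    · exact hlt.le
  have hy : x + (y - x) = y := add_tsub_cancel_of_le hle
  have hd0' : y 0 = 0 := hd0
  refine not_bounded_of_pump (v := y - x) (fun _ _ h => h) ?_
    (fun _ _ h => h.translate (by simp [hd0'])) (by rwa [hy]) hc
  intro h0
  rw [h0, add_zero] at hy
  subst hy
  exact lt_irrefl _ hlt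

theorem Walk.append {p q r : Q} {m n : ℕ} {δ ε : Fin 2 → ℤ} (h : Walk V p m δ q)
    (h' : Walk V q n ε r) : Walk V p (m + n) (δ + ε) r := by
  induction h with
  | nil => simpa using h'
  | cons ha _ ih =>
    have := Walk.cons ha (ih h')
    rwa [← add_assoc, add_right_comm] at this

theorem Walk.iterate {p : Q} {n : ℕ} {δ : Fin 2 → ℤ} (h : Walk V p n δ p) (k : ℕ) :
    Walk V p (k * n) (k • δ) p := by
  induction k with
  | zero => simpa using Walk.nil p
  | succ k ih =>
    have := ih.append h
    rwa [← Nat.succ_mul, ← succ_nsmul] at this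

theorem Walk.abs_le {p q : Q} {n : ℕ} {δ : Fin 2 → ℤ} (h : Walk V p n δ q) (i : Fin 2) :
    |δ i| ≤ n * V.actNorm := by
  induction h with
  | nil => simp
  | @cons p q r a δ n ha _ ih =>
    have h1 := ha.abs_le i
    have h2 : |(a + δ) i| ≤ |a i| + |δ i| := abs_add_le _ _
    push_cast
    linarith

theorem walk_of_reach {c d : Config 2 Q} (h : ReflTransGen (AddStep V) c d) :
    ∃ n, Walk V c.1 n (fun i => (d.2 i : ℤ) - c.2 i) d.1 := by
  induction h using ReflTransGen.head_induction_on with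
  | refl => exact ⟨0, by simpa using! Walk.nil d.1⟩
  | @head a b hs _ ih =>
    obtain ⟨e, he, hs⟩ := hs
    obtain ⟨n, hw⟩ := ih
    refine ⟨n + 1, ?_⟩
    convert Walk.cons he hw using 1
    funext i
    have := hs i
    simp only [Pi.add_apply]
    omega

/-- A walk can be executed from a large enough configuration. -/
theorem Walk.reach {p q : Q} {n : ℕ} {δ : Fin 2 → ℤ} (h : Walk V p n δ q) {x : Fin 2 → ℕ}
    (hx : ∀ i, n * V.actNorm ≤ x i) :
    ∃ y : Fin 2 → ℕ, (∀ i, (y i : ℤ) = x i + δ i) ∧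
      ReflTransGen (AddStep V) (p, x) (q, y) := by
  induction h generalizing x with
  | nil => exact ⟨x, by simp, .refl⟩
  | @cons p q r a δ n ha _ ih =>
    have hb : ∀ i, ((n * V.actNorm : ℕ) : ℤ) ≤ x i + a i := by
      intro i
      have h1 := _root_.abs_le.1 (ha.abs_le i)
      have h2 := hx i
      zify at h2 ⊢
      linarith
    have hnn : ∀ i, (((x i + a i).toNat : ℕ) : ℤ) = x i + a i := fun i =>
      Int.toNat_of_nonneg ((Nat.cast_nonneg _).trans (hb i))
    obtain ⟨y, hy, hr⟩ := ih (x := fun i => (x i + a i).toNat) (fun i => by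
      have := hb i
      have := hnn i
      omega)
    refine ⟨y, fun i => ?_, .head ⟨a, ha, hnn⟩ hr⟩
    rw [hy, hnn, Pi.add_apply, add_assoc]

/-- Vertices of a walk, as a function. -/
theorem Walk.exists_vertices {p q : Q} {n : ℕ} {δ : Fin 2 → ℤ} (h : Walk V p n δ q) :
    ∃ v : ℕ → Q, v 0 = p ∧ ∀ i j, i ≤ j → j ≤ n → ∃ δ₁ δ₂ δ₃, δ = δ₁ + δ₂ + δ₃ ∧
      Walk V p i δ₁ (v i) ∧ Walk V (v i) (j - i) δ₂ (v j) ∧ Walk V (v j) (n - j) δ₃ q := by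
  induction h with
  | nil p =>
    refine ⟨fun _ => p, rfl, fun i j hij hj => ?_⟩
    obtain rfl : j = 0 := by omega
    obtain rfl : i = 0 := by omega
    exact ⟨0, 0, 0, by simp, .nil p, .nil p, .nil p⟩
  | @cons p q r a δ n ha hw ih =>
    obtain ⟨v, hv0, hv⟩ := ih
    refine ⟨fun k => k.casesOn p v, rfl, fun i j hij hj => ?_⟩
    match i, j, hij with
    | 0, 0, _ => exact ⟨0, 0, a + δ, by simp, .nil p, .nil p, .cons ha hw⟩
    | 0, j + 1, _ =>
      obtain ⟨δ₁, δ₂, δ₃, rfl, h1, h2, h3⟩ := hv 0 j (Nat.zero_le _) (by omega)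
      refine ⟨0, a + (δ₁ + δ₂), δ₃, by simp [add_assoc], .nil p, ?_, ?_⟩
      · simpa using Walk.cons ha (h1.append h2)
      · simpa using h3
    | i + 1, j + 1, hij =>
      obtain ⟨δ₁, δ₂, δ₃, rfl, h1, h2, h3⟩ := hv i j (by omega) (by omega)
      refine ⟨a + δ₁, δ₂, δ₃, by simp [add_assoc], .cons ha h1, ?_, ?_⟩
      · simpa using h2
      · simpa using h3

variable [Fintype Q]

/-- A long walk contains a short cycle. -/
theorem Walk.exists_cycle {p q : Q} {n : ℕ} {δ : Fin 2 → ℤ} (h : Walk V p n δ q)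
    (hn : Fintype.card Q ≤ n) :
    ∃ r m₁ m₂ m₃ δ₁ δ₂ δ₃, Walk V p m₁ δ₁ r ∧ Walk V r m₂ δ₂ r ∧ Walk V r m₃ δ₃ q ∧
      0 < m₂ ∧ m₂ ≤ Fintype.card Q ∧ n = m₁ + m₂ + m₃ ∧ δ = δ₁ + δ₂ + δ₃ := by
  obtain ⟨v, -, hv⟩ := h.exists_vertices
  obtain ⟨i, j, hij, hvij⟩ := Fintype.exists_ne_map_eq_of_card_lt
    (fun k : Fin (Fintype.card Q + 1) => v k) (by simp)
  wlog hlt : i < j generalizing i j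
  · exact this j i hij.symm hvij.symm (lt_of_le_of_ne (not_lt.1 hlt) hij.symm)
  have hlt' : (i : ℕ) < j := hlt
  have hj := j.is_lt
  obtain ⟨δ₁, δ₂, δ₃, rfl, h1, h2, h3⟩ := hv i j hlt'.le (by omega)
  have hvij' : v i = v j := hvij
  rw [← hvij'] at h2 h3
  exact ⟨v i, _, _, _, _, _, _, h1, h2, h3, by omega, by omega, by omega, rfl⟩

theorem Walk.exists_short {p q : Q} {n : ℕ} {δ : Fin 2 → ℤ} (h : Walk V p n δ q) :
    ∃ m ε, m ≤ Fintype.card Q ∧ Walk V p m ε q := by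
  induction n using Nat.strong_induction_on generalizing δ with
  | _ n ih =>
  by_cases hn : n ≤ Fintype.card Q
  · exact ⟨n, δ, hn, h⟩
  obtain ⟨r, m₁, m₂, m₃, δ₁, δ₂, δ₃, h1, -, h3, h0, -, hsum, -⟩ := h.exists_cycle (by omega)
  exact ih (m₁ + m₃) (by omega) (h1.append h3)

/-- Effects of short cycles in the strongly connected component of `s`. -/
def shortCycles (V : TVASS 2 Q) (s : Q) : Set (Fin 2 → ℤ) :=
  {δ | ∃ r m k₁ k₂ ε₁ ε₂, Walk V r m δ r ∧ m ≤ Fintype.card Q ∧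
    Walk V s k₁ ε₁ r ∧ Walk V r k₂ ε₂ s}

theorem shortCycles_abs_le {s : Q} {u : Fin 2 → ℤ} (hu : u ∈ shortCycles V s) (i : Fin 2) :
    |u i| ≤ (Fintype.card Q * V.actNorm : ℕ) := by
  obtain ⟨r, m, -, -, -, -, h, hm, -⟩ := hu
  refine (h.abs_le i).trans ?_
  exact_mod_cast Nat.mul_le_mul_right _ hm

theorem shortCycles_finite (V : TVASS 2 Q) (s : Q) : (shortCycles V s).Finite := by
  refine (Set.finite_Icc (fun _ => -((Fintype.card Q * V.actNorm : ℕ) : ℤ))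
    (fun _ => ((Fintype.card Q * V.actNorm : ℕ) : ℤ))).subset fun u hu => ⟨fun i => ?_, fun i => ?_⟩
  · exact (_root_.abs_le.1 (shortCycles_abs_le hu i)).1
  · exact (_root_.abs_le.1 (shortCycles_abs_le hu i)).2

/-- A functional which is nonpositive on short cycles is nonpositive on all closed walks. -/
theorem Walk.functional_nonpos {s : Q} {n : ℕ} {δ : Fin 2 → ℤ} (h : Walk V s n δ s) {α β : ℤ}
    (hf : ∀ u ∈ shortCycles V s, α * u 0 + β * u 1 ≤ 0) : α * δ 0 + β * δ 1 ≤ 0 := by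
  induction n using Nat.strong_induction_on generalizing δ with
  | _ n ih =>
  by_cases hn : n ≤ Fintype.card Q
  · exact hf δ ⟨s, n, 0, 0, 0, 0, h, hn, .nil s, .nil s⟩
  obtain ⟨r, m₁, m₂, m₃, δ₁, δ₂, δ₃, h1, h2, h3, h0, hm, hsum, rfl⟩ :=
    h.exists_cycle (by omega)
  have e1 := ih (m₁ + m₃) (by omega) (h1.append h3)
  have e2 := hf δ₂ ⟨r, m₂, m₁, m₃, δ₁, δ₃, h2, hm, h1, h3⟩
  simp only [Pi.add_apply] at e1 ⊢
  linarith

end Walks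

/-- A bounded set of integer plane vectors either admits a small positive functional which is
nonpositive on it, or contains a nonnegative nonzero vector, or contains two vectors which
positively span a positive vector. -/
theorem plane_trichotomy {U : Set (Fin 2 → ℤ)} (hU : U.Finite) {D : ℤ} (hD : 1 ≤ D)
    (hb : ∀ u ∈ U, ∀ i, |u i| ≤ D) :
    (∃ α β : ℤ, 1 ≤ α ∧ α ≤ D ∧ 1 ≤ β ∧ β ≤ D ∧ ∀ u ∈ U, α * u 0 + β * u 1 ≤ 0) ∨
    (∃ u ∈ U, 0 < u) ∨
    (∃ u ∈ U, ∃ w ∈ U, u 0 < 0 ∧ 0 < u 1 ∧ 0 < w 0 ∧ w 1 < 0 ∧ 0 < u 1 * w 0 - u 0 * w 1) := by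
  by_cases hpos : ∃ u ∈ U, 0 < u
  · exact .inr (.inl hpos)
  by_cases hpair : ∃ u ∈ U, ∃ w ∈ U,
      u 0 < 0 ∧ 0 < u 1 ∧ 0 < w 0 ∧ w 1 < 0 ∧ 0 < u 1 * w 0 - u 0 * w 1
  · exact .inr (.inr hpair)
  left
  push Not at hpos hpair
  have hquad : ∀ u ∈ U, (u 0 ≤ 0 ∧ u 1 ≤ 0) ∨ (u 0 < 0 ∧ 0 < u 1) ∨ (0 < u 0 ∧ u 1 < 0) := by
    intro u hu
    by_contra! hcon
    obtain ⟨h1, h2, h3⟩ := hcon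
    refine hpos u hu (lt_of_le_of_ne (fun i => ?_) ?_)
    · fin_cases i
      · change 0 ≤ u 0
        by_contra! h
        have := h1 h.le
        have := h2 h
        omega
      · change 0 ≤ u 1
        by_contra! h
        by_cases h0 : u 0 ≤ 0
        · have := h1 h0
          omega
        · have := h3 (by omega)
          omega
    · rintro rfl
      simp at h1
  by_cases hneg : ∃ u ∈ U, u 0 < 0 ∧ 0 < u 1
  · have hfin : {u ∈ U | u 0 < 0 ∧ 0 < u 1}.Finite := hU.subset fun u hu => hu.1
    obtain ⟨u, ⟨huU, hu0, hu1⟩, hmax⟩ := hfin.exists_maximalFor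
      (fun u : Fin 2 → ℤ => (u 1 : ℚ) / (-u 0 : ℚ)) _ hneg
    have hu0b := _root_.abs_le.1 (hb u huU 0)
    have hu1b := _root_.abs_le.1 (hb u huU 1)
    refine ⟨u 1, -u 0, by omega, by omega, by omega, by omega, fun w hw => ?_⟩
    rcases hquad w hw with h | h | h
    · nlinarith
    · have hle : (w 1 : ℚ) / (-w 0 : ℚ) ≤ (u 1 : ℚ) / (-u 0 : ℚ) := by
        by_contra! hlt
        exact absurd (hmax ⟨hw, h⟩ hlt.le) (not_le.2 hlt)
      have e1 : (0 : ℚ) < -w 0 := by exact_mod_cast neg_pos.2 h.1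
      have e2 : (0 : ℚ) < -u 0 := by exact_mod_cast neg_pos.2 hu0
      rw [div_le_div_iff₀ e1 e2] at hle
      have : w 1 * -u 0 ≤ u 1 * -w 0 := by exact_mod_cast hle
      linarith
    · have := hpair u huU w hw hu0 hu1 h.1 h.2
      linarith
  · push Not at hneg
    refine ⟨1, D, le_refl _, hD, hD, le_refl _, fun w hw => ?_⟩
    have hw0 := _root_.abs_le.1 (hb w hw 0)
    rcases hquad w hw with h | h | h
    · nlinarith
    · exact absurd h.2 (not_lt.2 (hneg w hw h.1))
    · nlinarith

section Growth

open Relation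

variable {V : TVASS 2 Q} [Fintype Q]

/-- Length bound for pumping patterns. -/
def pumpLength (n D : ℕ) : ℕ := 3 * n + (2 * D + 1) * (4 * D) * n

/-- Either closed walks at `s` do not increase a small positive functional, or every state of
the strongly connected component of `s` starts a short walk to a positive cycle. -/
theorem functional_or_pump (s : Q) (hD : 1 ≤ Fintype.card Q * V.actNorm) :
    (∃ α β : ℤ, 1 ≤ α ∧ α ≤ (Fintype.card Q * V.actNorm : ℕ) ∧
      1 ≤ β ∧ β ≤ (Fintype.card Q * V.actNorm : ℕ) ∧
      ∀ n δ, Walk V s n δ s → α * δ 0 + β * δ 1 ≤ 0) ∨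
    ∀ t k₁ k₂ ε₁ ε₂, Walk V s k₁ ε₁ t → Walk V t k₂ ε₂ s →
      ∃ r m₁ m₂ δ₁ δ₂, Walk V t m₁ δ₁ r ∧ Walk V r m₂ δ₂ r ∧ 0 < δ₂ ∧
        m₁ + m₂ ≤ pumpLength (Fintype.card Q) (Fintype.card Q * V.actNorm) := by
  set N := Fintype.card Q with hN
  set D := N * V.actNorm with hDdef
  rcases plane_trichotomy (shortCycles_finite V s) (D := (D : ℤ)) (by exact_mod_cast hD)
    (fun u hu i => shortCycles_abs_le hu i) with h | ⟨u, hu, hpos⟩ |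
      ⟨u, hu, w, hw, hu0, hu1, hw0, hw1, hdet⟩
  · obtain ⟨α, β, h1, h2, h3, h4, hf⟩ := h
    exact .inl ⟨α, β, h1, h2, h3, h4, fun n δ hw => hw.functional_nonpos hf⟩
  · right
    intro t k₁ k₂ ε₁ ε₂ hst hts
    obtain ⟨r, m, _, _, _, _, hr, hm, hsr, -⟩ := hu
    obtain ⟨m₁, δ₁, hm₁, h1⟩ := (hts.append hsr).exists_short
    refine ⟨r, m₁, m, δ₁, u, h1, hr, hpos, ?_⟩
    unfold pumpLength
    omega
  · right
    intro t k₁ k₂ ε₁ ε₂ hst hts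
    have hub := fun i => _root_.abs_le.1 (shortCycles_abs_le hu i)
    have hwb := fun i => _root_.abs_le.1 (shortCycles_abs_le hw i)
    obtain ⟨r, m, _, _, _, _, hr, hm, hsr, hrs⟩ := hu
    obtain ⟨r', m', _, _, _, _, hr', hm', hsr', hrs'⟩ := hw
    obtain ⟨a, δa, ha, hwa⟩ := (hts.append hsr).exists_short
    obtain ⟨b, δb, hb, hwb'⟩ := (hrs.append hsr').exists_short
    obtain ⟨c, δc, hc, hwc⟩ := (hrs'.append hsr).exists_short
    obtain ⟨k, hk⟩ := Int.eq_ofNat_of_zero_le (show 0 ≤ w 0 - w 1 by omega)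
    obtain ⟨l, hl⟩ := Int.eq_ofNat_of_zero_le (show 0 ≤ u 1 - u 0 by omega)
    have hk' : k ≤ 2 * D := by
      have h1 := (hwb 0).2
      have h2 := (hwb 1).1
      rw [← hN, ← hDdef] at h1 h2
      change _ = (k : ℤ) at hk
      omega
    have hl' : l ≤ 2 * D := by
      have h1 := (hub 0).1
      have h2 := (hub 1).2
      rw [← hN, ← hDdef] at h1 h2
      change _ = (l : ℤ) at hl
      omega
    have hloop := ((hr.iterate ((2 * D + 1) * k)).append hwb').append
      ((hr'.iterate ((2 * D + 1) * l)).append hwc)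
    have hbig : ∀ (x : Q) (j : ℕ) (δ : Fin 2 → ℤ) (y : Q), j ≤ N → Walk V x j δ y →
        ∀ i, -(D : ℤ) ≤ δ i := by
      intro x j δ y hj hxy i
      have h1 := (_root_.abs_le.1 (hxy.abs_le i)).1
      have h2 : ((j * V.actNorm : ℕ) : ℤ) ≤ (N * V.actNorm : ℕ) := by
        exact_mod_cast Nat.mul_le_mul_right _ hj
      push_cast at h2
      rw [hDdef]
      push_cast
      linarith
    have hcoord : ∀ i, (k : ℤ) * u i + l * w i = u 1 * w 0 - u 0 * w 1 := by
      intro i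
      have hk1 : (k : ℤ) = w 0 - w 1 := by rw [hk]
      have hl1 : (l : ℤ) = u 1 - u 0 := by rw [hl]
      rw [hk1, hl1]
      fin_cases i <;> simp <;> ring
    have hposi : ∀ i, 0 < ((((2 * D + 1) * k) • u + δb) + (((2 * D + 1) * l) • w + δc)) i := by
      intro i
      have e1 := hbig _ _ _ _ hb hwb' i
      have e2 := hbig _ _ _ _ hc hwc i
      have e3 := hcoord i
      have e4 : ((((2 * D + 1) * k) • u + δb) + (((2 * D + 1) * l) • w + δc)) i
          = (2 * (D : ℤ) + 1) * (k * u i + l * w i) + δb i + δc i := by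
        simp
        ring
      rw [e4, e3]
      nlinarith
    refine ⟨r, a, _, δa, _, hwa, hloop, ?_, ?_⟩
    · refine lt_of_le_of_ne (fun i => (hposi i).le) fun h => ?_
      have h0 := hposi 0
      rw [← h] at h0
      exact lt_irrefl _ h0
    · have e1 : k * m ≤ 2 * D * N := Nat.mul_le_mul hk' hm
      have e2 : l * m' ≤ 2 * D * N := Nat.mul_le_mul hl' hm'
      have e3 : (2 * D + 1) * (k * m + l * m') ≤ (2 * D + 1) * (2 * D * N + 2 * D * N) :=
        Nat.mul_le_mul_left _ (add_le_add e1 e2)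
      unfold pumpLength
      calc a + ((2 * D + 1) * k * m + b + ((2 * D + 1) * l * m' + c))
          = a + b + c + (2 * D + 1) * (k * m + l * m') := by ring
        _ ≤ N + N + N + (2 * D + 1) * (2 * D * N + 2 * D * N) := by omega
        _ = 3 * N + (2 * D + 1) * (4 * D) * N := by ring

omit [Fintype Q] in
/-- If a positive cycle can be reached by a short walk from the state of a configuration of a
bounded system, then one of the counters is small. -/
theorem Bounded.exists_lt {t r : Q} {x : Fin 2 → ℕ} {m₁ m₂ L : ℕ} {δ₁ δ₂ : Fin 2 → ℤ}
    (hb : Bounded V (t, x)) (h₁ : Walk V t m₁ δ₁ r) (h₂ : Walk V r m₂ δ₂ r) (hpos : 0 < δ₂)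
    (hL : m₁ + m₂ ≤ L) : ∃ i, x i < L * V.actNorm := by
  by_contra! hx
  have hlen : (m₁ + m₂) * V.actNorm ≤ L * V.actNorm := Nat.mul_le_mul_right _ hL
  rw [add_mul] at hlen
  obtain ⟨y, hy, hr⟩ := h₁.reach (x := x) fun i => by have := hx i; omega
  have hy' : ∀ i, m₂ * V.actNorm ≤ y i := by
    intro i
    have e1 := (_root_.abs_le.1 (h₁.abs_le i)).1
    have e2 := hx i
    have e3 := hy i
    zify at hlen e2 ⊢
    linarith
  obtain ⟨z, hz, hr'⟩ := h₂.reach hy'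
  refine (hb.of_reach (AddStep.reach hr)).not_lt hr' rfl ?_
  refine lt_of_le_of_ne (fun i => ?_) ?_
  · have e1 := hz i
    have e2 : 0 ≤ δ₂ i := hpos.le i
    change y i ≤ z i
    omega
  · intro h
    refine hpos.ne ?_
    funext i
    have e1 := hz i
    have e2 : y i = z i := congrFun h i
    simp only [Pi.zero_apply]
    omega

omit [Fintype Q] in
theorem AddStep.le_add {c d : Config 2 Q} (h : AddStep V c d) (i : Fin 2) :
    d.2 i ≤ c.2 i + V.actNorm := by
  obtain ⟨a, ha, h⟩ := h
  have h1 := h i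
  have h2 := (_root_.abs_le.1 (ha.abs_le i)).2
  omega

/-- Growth of a counter while the other one stays below `B`. -/
theorem Bounded.le_of_other_lt {c d : Config 2 Q} (hc : Bounded V c) {i j : Fin 2} (hij : i ≠ j)
    {B : ℕ} (hcB : c.2 j < B)
    (h : ReflTransGen (fun a b => AddStep V a b ∧ b.2 j < B) c d) :
    d.2 i ≤ c.2 i + Fintype.card Q * B * V.actNorm := by
  have := chain_growth (R := AddStep V) (fun c : Config 2 Q => (c.1, c.2 j)) (fun c => c.2 i)
    (Bounded V) (fun c d hc h => hc.of_reach (.single h.step)) (F := id)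
    (G := fun n => n + V.actNorm) (fun n => le_refl _) (fun n => Nat.le_add_right _ _)
    (fun a b hab => Nat.add_le_add_right hab _) monotone_id
    (fun c d hc h hk => by
      obtain ⟨hk1, hk2⟩ := Prod.ext_iff.1 hk
      by_contra! hlt
      have hlt' : c.2 i < d.2 i := hlt
      refine hc.not_lt h hk1 (lt_of_le_of_ne (fun l => ?_) fun h => ?_)
      · rcases (show l = i ∨ l = j by omega) with rfl | rfl
        · exact hlt'.le
        · exact hk2.ge
      · rw [h] at hlt'
        exact lt_irrefl _ hlt')
    (fun c d _ h => h.le_add i) (Finset.univ ×ˢ Finset.range B) c d hc (by simpa using hcB)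
    (chain_mono h fun a b h => ⟨h.1, by simpa using h.2⟩)
  have hit : ∀ k n : ℕ, ((fun n => n + V.actNorm) ∘ id)^[k] n = n + k * V.actNorm := by
    intro k
    induction k with
    | zero => simp
    | succ k ih =>
      intro n
      rw [Function.iterate_succ_apply, ih]
      simp only [Function.comp, id]
      ring
  rw [hit, Finset.card_product, Finset.card_univ, Finset.card_range] at this
  exact this

/-- Growth of a counter along a chain on which one counter is always below `B`. -/
theorem Bounded.le_of_min_lt {c d : Config 2 Q} (hc : Bounded V c) (i : Fin 2) {B : ℕ}
    (h : ReflTransGen (fun a b => AddStep V a b ∧ ∃ l, b.2 l < B) c d) :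
    d.2 i ≤ max (c.2 i) B + V.actNorm + Fintype.card Q * B * V.actNorm := by
  obtain ⟨j, hij⟩ : ∃ j : Fin 2, i ≠ j := ⟨i + 1, by fin_cases i <;> simp⟩
  set H := max (c.2 i) B
  obtain ⟨e, he, hke, h'⟩ := exists_last_visit (fun c : Config 2 Q => c.2 i ≤ H) h
  have hcH : (c.2 i ≤ H) = True := eq_true (le_max_left _ _)
  have hBH : B ≤ H := le_max_right _ _
  simp only [hcH, eq_iff_iff, iff_true, ne_eq, not_le] at hke h'
  have hsmall : ∀ b : Config 2 Q, (∃ l, b.2 l < B) → H < b.2 i → b.2 j < B := by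
    rintro b ⟨l, hl⟩ hi
    rcases (show l = i ∨ l = j by omega) with rfl | rfl
    · omega
    · exact hl
  obtain rfl | ⟨f, ⟨hef, hfB⟩, hf, hfd⟩ := h'
  · omega
  · have hreach : ReflTransGen (AddStep V) c f := (chain_mono he fun _ _ h => h.1).tail hef
    have := (hc.of_reach (AddStep.reach hreach)).le_of_other_lt hij (hsmall f hfB hf)
      (chain_mono hfd fun a b h => ⟨h.1.1, hsmall b h.1.2 h.2⟩)
    have := hef.le_add i
    omega

theorem le_vnorm (x : Fin 2 → ℕ) (i : Fin 2) : x i ≤ vnorm x :=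
  Finset.le_sup (f := x) (Finset.mem_univ i)

theorem vnorm_le {x : Fin 2 → ℕ} {N : ℕ} (h : ∀ i, x i ≤ N) : vnorm x ≤ N :=
  Finset.sup_le fun i _ => h i

/-- Growth along a test-free loop. -/
theorem Bounded.loop_growth {c d : Config 2 Q} (hc : Bounded V c)
    (hD : 1 ≤ Fintype.card Q * V.actNorm)
    (h : ReflTransGen (AddStep V) c d) (hs : d.1 = c.1) :
    vnorm d.2 + 1 ≤ (Fintype.card Q + V.actNorm) ^ 14 * (vnorm c.2 + 1) := by
  set n := Fintype.card Q with hn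
  set M := V.actNorm with hM
  have hn1 : 1 ≤ n := Nat.pos_of_mul_pos_right hD
  have hM1 : 1 ≤ M := Nat.pos_of_mul_pos_left hD
  set b := n + M with hb
  have hb2 : 2 ≤ b := by omega
  have hnM : n * M ≤ b ^ 2 := by rw [sq]; exact Nat.mul_le_mul (by omega) (by omega)
  rcases functional_or_pump (V := V) c.1 hD with ⟨α, β, hα, hα', hβ, hβ', hf⟩ | hpump
  · obtain ⟨m, hw⟩ := walk_of_reach h
    rw [hs] at hw
    have hle := hf m _ hw
    have hdb : vnorm d.2 ≤ 2 * b ^ 2 * vnorm c.2 := by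
      have hc0 := le_vnorm c.2 0
      have hc1 := le_vnorm c.2 1
      have e : (α : ℤ) * d.2 0 + β * d.2 1 ≤ 2 * b ^ 2 * vnorm c.2 := by
        have hnM' : ((n * M : ℕ) : ℤ) ≤ b ^ 2 := by exact_mod_cast hnM
        have e1 : α * (c.2 0 : ℤ) ≤ b ^ 2 * vnorm c.2 :=
          mul_le_mul (hα'.trans hnM') (by exact_mod_cast hc0) (by positivity) (by positivity)
        have e2 : β * (c.2 1 : ℤ) ≤ b ^ 2 * vnorm c.2 :=
          mul_le_mul (hβ'.trans hnM') (by exact_mod_cast hc1) (by positivity) (by positivity)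
        linarith
      refine vnorm_le fun i => ?_
      zify
      have p0 : (0 : ℤ) ≤ d.2 0 := Nat.cast_nonneg _
      have p1 : (0 : ℤ) ≤ d.2 1 := Nat.cast_nonneg _
      fin_cases i
      · change ((d.2 0 : ℕ) : ℤ) ≤ _
        nlinarith
      · change ((d.2 1 : ℕ) : ℤ) ≤ _
        nlinarith
    have h3 : 2 * b ^ 2 ≤ b ^ 14 := by
      calc 2 * b ^ 2 ≤ b * b ^ 2 := Nat.mul_le_mul_right _ hb2
        _ = b ^ 3 := by ring
        _ ≤ b ^ 14 := Nat.pow_le_pow_right (by omega) (by norm_num)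
    have h4 : 1 ≤ b ^ 14 := Nat.one_le_pow _ _ (by omega)
    nlinarith
  · set L := pumpLength n (n * M) with hL
    have hmin : ReflTransGen (fun a b => AddStep V a b ∧ ∃ l, b.2 l < L * M) c d := by
      refine reflTransGen_restrict h fun e he he' => ?_
      obtain ⟨k₁, hw₁⟩ := walk_of_reach he
      obtain ⟨k₂, hw₂⟩ := walk_of_reach he'
      rw [hs] at hw₂
      obtain ⟨r, m₁, m₂, δ₁, δ₂, h1, h2, hpos, hlen⟩ := hpump _ _ _ _ _ hw₁ hw₂
      exact (hc.of_reach (AddStep.reach he)).exists_lt h1 h2 hpos hlen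
    have hB : L * M ≤ b ^ 10 := by
      have hLb : L ≤ b ^ 9 := by
        calc L = 3 * n + (2 * (n * M) + 1) * (4 * (n * M)) * n := rfl
          _ ≤ 3 * b + (2 * b ^ 2 + b ^ 2) * (4 * b ^ 2) * b := by
            have : 1 ≤ b ^ 2 := Nat.one_le_pow _ _ (by omega)
            gcongr
            · omega
            · omega
          _ = 3 * b ^ 1 + 12 * b ^ 5 := by ring
          _ ≤ 3 * b ^ 5 + 12 * b ^ 5 := by
            gcongr
            · omega
            · norm_num
          _ = 15 * b ^ 5 := by ring
          _ ≤ b ^ 4 * b ^ 5 := by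
            gcongr
            calc 15 ≤ 2 ^ 4 := by norm_num
              _ ≤ b ^ 4 := Nat.pow_le_pow_left hb2 4
          _ = b ^ 9 := by ring
      calc L * M ≤ b ^ 9 * b := Nat.mul_le_mul hLb (by omega)
        _ = b ^ 10 := by ring
    have hdb : vnorm d.2 ≤ vnorm c.2 + 3 * b ^ 12 := by
      refine vnorm_le fun i => ?_
      have e1 := hc.le_of_min_lt i hmin
      rw [← hn, ← hM] at e1
      have e2 := le_vnorm c.2 i
      have e3 : n * (L * M) * M ≤ b ^ 12 := by
        calc n * (L * M) * M ≤ b * b ^ 10 * b := by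
              gcongr
              · omega
              · omega
          _ = b ^ 12 := by ring
      have e4 : b ^ 10 ≤ b ^ 12 := Nat.pow_le_pow_right (by omega) (by norm_num)
      have e5 : b ≤ b ^ 12 := Nat.le_self_pow (by norm_num) b
      omega
    have h3 : 3 * b ^ 12 + 1 ≤ b ^ 14 := by
      have h1 : 1 ≤ b ^ 12 := Nat.one_le_pow _ _ (by omega)
      calc 3 * b ^ 12 + 1 ≤ 2 ^ 2 * b ^ 12 := by omega
        _ ≤ b ^ 2 * b ^ 12 := by gcongr
        _ = b ^ 14 := by ring
    have h4 : 1 ≤ b ^ 14 := Nat.one_le_pow _ _ (by omega)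
    nlinarith

theorem iterate_mul (A k n : ℕ) : (fun n => A * n)^[k] n = A ^ k * n := by
  rw [mul_left_iterate]

/-- Growth along a test-free chain. -/
theorem Bounded.add_growth {c d : Config 2 Q} (hc : Bounded V c)
    (hD : 1 ≤ Fintype.card Q * V.actNorm) (h : ReflTransGen (AddStep V) c d) :
    vnorm d.2 + 1 ≤
      (Fintype.card Q + V.actNorm) ^ (15 * Fintype.card Q) * (vnorm c.2 + 1) := by
  set b := Fintype.card Q + V.actNorm with hb
  have hn1 : 1 ≤ Fintype.card Q := Nat.pos_of_mul_pos_right hD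
  have hb1 : 1 ≤ b := by omega
  have := chain_growth (R := AddStep V) (fun c : Config 2 Q => c.1) (fun c => vnorm c.2 + 1)
    (Bounded V) (fun c d hc h => hc.of_reach (.single h.step)) (F := fun n => b ^ 14 * n)
    (G := fun n => b * n) (fun n => Nat.le_mul_of_pos_left _ (by positivity))
    (fun n => Nat.le_mul_of_pos_left _ (by positivity))
    (fun x y h => Nat.mul_le_mul_left _ h) (fun x y h => Nat.mul_le_mul_left _ h)
    (fun c d hc h hk => hc.loop_growth hD h hk)
    (fun c d _ h => by
      have h1 : vnorm d.2 ≤ vnorm c.2 + V.actNorm :=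
        vnorm_le fun i => (h.le_add i).trans (Nat.add_le_add_right (le_vnorm _ i) _)
      have h2 : V.actNorm + 1 ≤ b := by omega
      change vnorm d.2 + 1 ≤ b * (vnorm c.2 + 1)
      nlinarith)
    Finset.univ c d hc (Finset.mem_univ _) (chain_mono h fun a b h => ⟨h, Finset.mem_univ _⟩)
  have hcomp : (fun n => b * n) ∘ (fun n => b ^ 14 * n) = fun n => b ^ 15 * n := by
    funext n
    simp only [Function.comp]
    ring
  rwa [hcomp, iterate_mul, ← pow_mul, Finset.card_univ] at this

/-- Test-free chains and zero-tests between configurations with first counter zero. -/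
def ZeroStep (V : TVASS 2 Q) (c d : Config 2 Q) : Prop :=
  c.2 0 = 0 ∧ d.2 0 = 0 ∧ (ReflTransGen (AddStep V) c d ∨ (Step V c d ∧ d.2 = c.2))

omit [Fintype Q] in
theorem ZeroStep.reach {c d : Config 2 Q} (h : ReflTransGen (ZeroStep V) c d) :
    ReflTransGen (Step V) c d := by
  induction h with
  | refl => exact .refl
  | tail _ hs ih =>
    rcases hs.2.2 with h | h
    · exact ih.trans (AddStep.reach h)
    · exact ih.tail h.1

/-- Growth along a chain of configurations with first counter zero. -/
theorem Bounded.zero_growth {c d : Config 2 Q} (hc : Bounded V c) (hc0 : c.2 0 = 0)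
    (hD : 1 ≤ Fintype.card Q * V.actNorm) (h : ReflTransGen (ZeroStep V) c d) :
    vnorm d.2 + 1 ≤ ((Fintype.card Q + V.actNorm) ^ (15 * Fintype.card Q)) ^ Fintype.card Q *
      (vnorm c.2 + 1) := by
  set A := (Fintype.card Q + V.actNorm) ^ (15 * Fintype.card Q) with hA
  have hn1 : 1 ≤ Fintype.card Q := Nat.pos_of_mul_pos_right hD
  have hA1 : 0 < A := by positivity
  have := chain_growth (R := ZeroStep V) (fun c : Config 2 Q => c.1) (fun c => vnorm c.2 + 1)
    (fun c => Bounded V c ∧ c.2 0 = 0)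
    (fun c d hc h => ⟨hc.1.of_reach (ZeroStep.reach (.single h)), h.2.1⟩) (F := id)
    (G := fun n => A * n) (fun n => le_refl _)
    (fun n => Nat.le_mul_of_pos_left _ hA1) (fun x y h => Nat.mul_le_mul_left _ h) monotone_id
    (fun c d hc h hk => by
      have hd0 : d.2 0 = 0 := by
        rcases ReflTransGen.cases_tail h with rfl | ⟨e, -, he⟩
        · exact hc.2
        · exact he.2.1
      have h1 := hc.1.zero_le (ZeroStep.reach h) hk hc.2 hd0
      refine Nat.add_le_add_right (vnorm_le fun i => ?_) 1
      fin_cases i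
      · exact hd0.le.trans (Nat.zero_le _)
      · exact h1.trans (le_vnorm _ 1))
    (fun c d hc h => by
      rcases h.2.2 with h | h
      · exact hc.1.add_growth hD h
      · rw [h.2]
        exact Nat.le_mul_of_pos_left _ hA1)
    Finset.univ c d ⟨hc, hc0⟩ (Finset.mem_univ _) (chain_mono h fun a b h => ⟨h, Finset.mem_univ _⟩)
  rwa [Function.comp_id, iterate_mul, Finset.card_univ] at this

omit [Fintype Q] in
theorem reach_decompose {c d : Config 2 Q} (h : ReflTransGen (Step V) c d) :
    ReflTransGen (AddStep V) c d ∨ ∃ z z' : Config 2 Q, z.2 0 = 0 ∧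
      ReflTransGen (AddStep V) c z ∧ ReflTransGen (ZeroStep V) z z' ∧ z'.2 0 = 0 ∧
      ReflTransGen (AddStep V) z' d := by
  induction h with
  | refl => exact .inl .refl
  | @tail m d hm hs ih =>
    rcases step_cases hs with ha | ⟨hm0, hd⟩
    · rcases ih with h | ⟨z, z', hz, h1, h2, hz', h3⟩
      · exact .inl (h.tail ha)
      · exact .inr ⟨z, z', hz, h1, h2, hz', h3.tail ha⟩
    · have hd0 : d.2 0 = 0 := by rw [hd, hm0]
      have hmd : ZeroStep V m d := ⟨hm0, hd0, .inr ⟨hs, hd⟩⟩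
      rcases ih with h | ⟨z, z', hz, h1, h2, hz', h3⟩
      · exact .inr ⟨m, d, hm0, h, .single hmd, hd0, .refl⟩
      · exact .inr ⟨z, d, hz, h1, (h2.tail ⟨hz', hm0, .inl h3⟩).tail hmd, hd0, .refl⟩

omit [Fintype Q] in
theorem reach_eq_of_actNorm_eq_zero (hM : V.actNorm = 0) {c d : Config 2 Q}
    (h : ReflTransGen (Step V) c d) : d.2 = c.2 := by
  induction h with
  | refl => rfl
  | tail _ hs ih =>
    rw [← ih]
    rcases step_cases hs with ⟨a, ha, hs⟩ | h
    · funext i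
      have h1 := ha.abs_le i
      have h2 := hs i
      rw [hM, Nat.cast_zero, abs_nonpos_iff] at h1
      omega
    · exact h.2

theorem Bounded.growth {c d : Config 2 Q} (hc : Bounded V c)
    (hD : 1 ≤ Fintype.card Q * V.actNorm) (h : ReflTransGen (Step V) c d) :
    vnorm d.2 + 1 ≤
      (Fintype.card Q + V.actNorm) ^ (45 * Fintype.card Q ^ 3) * (vnorm c.2 + 1) := by
  set n := Fintype.card Q with hn
  set b := n + V.actNorm with hb
  have hn1 : 1 ≤ n := Nat.pos_of_mul_pos_right hD
  have hb1 : 0 < b := by omega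
  have hn13 : n ≤ n ^ 3 := Nat.le_self_pow (by norm_num) n
  have hn23 : n ^ 2 ≤ n ^ 3 := Nat.pow_le_pow_right hn1 (by norm_num)
  rcases reach_decompose h with h | ⟨z, z', hz, h1, h2, -, h3⟩
  · refine (hc.add_growth hD h).trans (Nat.mul_le_mul_right _ (Nat.pow_le_pow_right hb1 ?_))
    omega
  · have hbz := hc.of_reach (AddStep.reach h1)
    have hbz' := hbz.of_reach (ZeroStep.reach h2)
    have e1 := hc.add_growth hD h1
    have e2 := hbz.zero_growth hz hD h2
    have e3 := hbz'.add_growth hD h3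
    calc vnorm d.2 + 1 ≤ b ^ (15 * n) * ((b ^ (15 * n)) ^ n *
          (b ^ (15 * n) * (vnorm c.2 + 1))) :=
        e3.trans (Nat.mul_le_mul_left _ (e2.trans (Nat.mul_le_mul_left _ e1)))
      _ = b ^ (30 * n + 15 * n ^ 2) * (vnorm c.2 + 1) := by ring
      _ ≤ b ^ (45 * n ^ 3) * (vnorm c.2 + 1) :=
        Nat.mul_le_mul_right _ (Nat.pow_le_pow_right hb1 (by omega))

end Growth

/-- Corollary: reachable configurations of bounded 2-TVASS are small. -/
theorem bounded_2TVASS_reach_norm :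
    ∃ c : ℕ, 1 ≤ c ∧
      ∀ (Q : Type) [Fintype Q] [Nonempty Q] (V : TVASS 2 Q)
        (p : Q) (x : Fin 2 → ℕ),
        {c' : Config 2 Q | Reach V (p, x) c'}.Finite →
        ∀ (q : Q) (y : Fin 2 → ℕ), Reach V (p, x) (q, y) →
          vnorm y ≤
            (1 + vnorm x) * (Fintype.card Q + V.actNorm) ^ (c * Fintype.card Q ^ 3) := by
  refine ⟨45, by norm_num, fun Q _ _ V p x hfin q y hreach => ?_⟩
  have hr := reach_iff.1 hreach
  have hb : Bounded V (p, x) := hfin.subset fun _ h => reach_iff.2 h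
  have hn1 : 1 ≤ Fintype.card Q := Fintype.card_pos
  rcases Nat.eq_zero_or_pos V.actNorm with hM | hM
  · have hyx : y = x := reach_eq_of_actNorm_eq_zero hM hr
    subst hyx
    exact (Nat.le_add_left _ 1).trans (Nat.le_mul_of_pos_right _ (by positivity))
  · have h : vnorm y + 1 ≤ _ := hb.growth (Nat.mul_pos hn1 hM) hr
    refine (Nat.le_succ _).trans (h.trans_eq ?_)
    rw [mul_comm, add_comm]

end TVASSpaper
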